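/- Let f : [0,∞) → ℝ be operator convex with f(0) ≤ 0, and let Φ be a positive linear map from bounded operators on H to bounded operators on K with Φ(I) ≤ I. Then for every positive operator A on H and every strictly positive operator B on H such that Φ(B) is strictly positive, g(Φ(A),Φ(B)) ≤ Φ(g(A,B)) in the Loewner order. -/

import Mathlib

open scoped InnerProductSpace

noncomputable section

/-- A continuous function `f : [0, ∞) → ℝ` is *operator convex* if for every complex Hilbert
space `K`, all selfadjoint operators `A, B` on `K` with spectra in `[0, ∞)` and every
`λ ∈ [0, 1]` one has `f(λA + (1-λ)B) ≤ λ f(A) + (1-λ) f(B)` in the Loewner order, where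
`f(A)` is given by the continuous functional calculus. -/
def OperatorConvexOn (f : ℝ → ℝ) : Prop :=
  ∀ (K : Type) [NormedAddCommGroup K] [InnerProductSpace ℂ K] [CompleteSpace K],
    ∀ A B : K →L[ℂ] K, IsSelfAdjoint A → IsSelfAdjoint B →
      spectrum ℝ A ⊆ Set.Ici (0 : ℝ) → spectrum ℝ B ⊆ Set.Ici (0 : ℝ) →
      ∀ lam : ℝ, lam ∈ Set.Icc (0 : ℝ) 1 →
        cfc f (lam • A + (1 - lam) • B) ≤ lam • cfc f A + (1 - lam) • cfc f B

variable {H : Type} [NormedAddCommGroup H] [InnerProductSpace ℂ H] [CompleteSpace H]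

/-- `R^{1/2}` via the continuous functional calculus. -/
def opSqrt (R : H →L[ℂ] H) : H →L[ℂ] H := cfc Real.sqrt R

/-- `R^{-1/2}` via the continuous functional calculus. -/
def opInvSqrt (R : H →L[ℂ] H) : H →L[ℂ] H := cfc (fun t : ℝ => (Real.sqrt t)⁻¹) R

/-- The non-commutative perspective `g(L, R) = R^{1/2} f(R^{-1/2} L R^{-1/2}) R^{1/2}`. -/
def persp (f : ℝ → ℝ) (L R : H →L[ℂ] H) : H →L[ℂ] H :=
  opSqrt R * cfc f (opInvSqrt R * L * opInvSqrt R) * opSqrt R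

open ContinuousLinearMap in
/-- The continuous functional calculus respects intertwining operators. -/
lemma cfc_comp_of_intertwining {E F : Type*} [NormedAddCommGroup E] [InnerProductSpace ℂ E]
    [CompleteSpace E] [NormedAddCommGroup F] [InnerProductSpace ℂ F] [CompleteSpace F]
    {f : ℝ → ℝ} (hf : ContinuousOn f (Set.Ici 0)) {D : F →L[ℂ] F} {S : E →L[ℂ] E}
    (hD : 0 ≤ D) (hS : 0 ≤ S) {V : E →L[ℂ] F} (h : D ∘L V = V ∘L S) :
    cfc f D ∘L V = V ∘L cfc f S := by
  have hpoly (p : Polynomial ℝ) : cfc p.eval D ∘L V = V ∘L cfc p.eval S := by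
    rw [cfc_polynomial p D, cfc_polynomial p S]
    induction p using Polynomial.induction_on' with
    | add p q hp hq => simp only [map_add, add_comp, comp_add, hp, hq]
    | monomial n a =>
      have hpow : (D ^ n) ∘L V = V ∘L (S ^ n) := by
        induction n with
        | zero => ext x; simp
        | succ n ih =>
          rw [pow_succ, pow_succ', mul_def, mul_def, comp_assoc, h, ← comp_assoc, ih, comp_assoc,
            ← mul_def, ← mul_def, ← pow_succ, ← pow_succ']
      ext x
      have := congr($hpow x)
      simp only [Polynomial.aeval_monomial, Algebra.algebraMap_eq_smul_one, smul_mul_assoc,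
        one_mul, comp_apply, smul_apply] at this ⊢
      rw [this, ← Complex.coe_smul, ← Complex.coe_smul, map_smul]
  set M : ℝ := max (‖D‖ * ‖(1 : F →L[ℂ] F)‖) (‖S‖ * ‖(1 : E →L[ℂ] E)‖)
  have hDs (x : ℝ) (hx : x ∈ spectrum ℝ D) : x ∈ Set.Icc 0 M :=
    ⟨spectrum_nonneg_of_nonneg hD hx,
      (le_abs_self x).trans ((spectrum.norm_le_norm_mul_of_mem hx).trans (le_max_left _ _))⟩
  have hSs (x : ℝ) (hx : x ∈ spectrum ℝ S) : x ∈ Set.Icc 0 M :=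
    ⟨spectrum_nonneg_of_nonneg hS hx,
      (le_abs_self x).trans ((spectrum.norm_le_norm_mul_of_mem hx).trans (le_max_right _ _))⟩
  have hfM : ContinuousOn f (Set.Icc 0 M) := hf.mono fun x hx => hx.1
  rw [← sub_eq_zero, ← norm_le_zero_iff]
  refine le_of_forall_pos_le_add fun ε hε => ?_
  obtain ⟨p, hp⟩ := exists_polynomial_near_of_continuousOn 0 M f hfM (ε / (2 * (‖V‖ + 1)))
    (by positivity)
  have h1 : ‖cfc p.eval D - cfc f D‖ ≤ ε / (2 * (‖V‖ + 1)) := by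
    rw [← cfc_sub _ _ D (by fun_prop) (hfM.mono hDs)]
    exact norm_cfc_le (by positivity) fun x hx => (hp x (hDs x hx)).le
  have h2 : ‖cfc p.eval S - cfc f S‖ ≤ ε / (2 * (‖V‖ + 1)) := by
    rw [← cfc_sub _ _ S (by fun_prop) (hfM.mono hSs)]
    exact norm_cfc_le (by positivity) fun x hx => (hp x (hSs x hx)).le
  have h3 : cfc f D ∘L V - V ∘L cfc f S =
      V ∘L (cfc p.eval S - cfc f S) - (cfc p.eval D - cfc f D) ∘L V := by
    rw [comp_sub, sub_comp, hpoly p]; abel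
  calc ‖cfc f D ∘L V - V ∘L cfc f S‖
      ≤ ‖V‖ * ‖cfc p.eval S - cfc f S‖ + ‖cfc p.eval D - cfc f D‖ * ‖V‖ := by
        rw [h3]
        exact (norm_sub_le _ _).trans (add_le_add (opNorm_comp_le _ _) (opNorm_comp_le _ _))
    _ ≤ ‖V‖ * (ε / (2 * (‖V‖ + 1))) + ε / (2 * (‖V‖ + 1)) * ‖V‖ := by gcongr
    _ = ε * (‖V‖ / (‖V‖ + 1)) := by field_simp; ring
    _ ≤ ε * 1 := by
        gcongr
        rw [div_le_one (by positivity)]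
        linarith
    _ = 0 + ε := by ring

open ContinuousLinearMap in
/-- Compression of an operator inequality by a bounded operator. -/
lemma adjoint_comp_mono {E F : Type*} [NormedAddCommGroup E] [InnerProductSpace ℂ E]
    [CompleteSpace E] [NormedAddCommGroup F] [InnerProductSpace ℂ F] [CompleteSpace F]
    {S T : F →L[ℂ] F} (h : S ≤ T) (V : E →L[ℂ] F) :
    adjoint V ∘L S ∘L V ≤ adjoint V ∘L T ∘L V := by
  rw [le_def] at h ⊢
  rw [← comp_sub, ← sub_comp]
  exact h.adjoint_conj V

open ContinuousLinearMap in
/-- Jensen's operator inequality for the compression by an isometry. -/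
lemma OperatorConvexOn.cfc_compression_le {E F : Type} [NormedAddCommGroup E]
    [InnerProductSpace ℂ E] [CompleteSpace E] [NormedAddCommGroup F] [InnerProductSpace ℂ F]
    [CompleteSpace F] {f : ℝ → ℝ} (hf : OperatorConvexOn f) (hfc : ContinuousOn f (Set.Ici 0))
    {V : E →L[ℂ] F} (hV : adjoint V ∘L V = 1) {T : F →L[ℂ] F} (hT : 0 ≤ T) :
    cfc f (adjoint V ∘L T ∘L V) ≤ adjoint V ∘L cfc f T ∘L V := by
  set S := adjoint V ∘L T ∘L V with hSdef
  have hS : 0 ≤ S := by simpa [hSdef] using adjoint_comp_mono hT V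
  set P : F →L[ℂ] F := V ∘L adjoint V with hP
  set U : F →L[ℂ] F := (2 : ℝ) • P - 1 with hU
  have hPV : P ∘L V = V := by rw [hP, comp_assoc, hV]; ext x; simp
  have hPP : P * P = P := by
    rw [mul_def]
    conv_lhs => rw [hP, ← comp_assoc, ← hP, hPV]
  have hPs : star P = P := by
    rw [star_eq_adjoint, hP, adjoint_comp, adjoint_adjoint]
  have hUs : star U = U := by simp [hU, hPs]
  have hUU : U * U = 1 := by
    simp only [hU, sub_mul, mul_sub, smul_mul_assoc, mul_smul_comm, hPP, mul_one, one_mul]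
    module
  have hUV : U ∘L V = V := by
    ext x
    have := congr($hPV x)
    simp only [comp_apply] at this
    simp [hU, this, two_smul]
  have hVU : adjoint V ∘L U = adjoint V := by
    have := congr(adjoint $hUV)
    rwa [adjoint_comp, ← star_eq_adjoint U, hUs] at this
  have hUT : 0 ≤ U * T * U := by
    simpa [hUs] using star_left_conjugate_nonneg hT U
  set D : F →L[ℂ] F := (1 / 2 : ℝ) • T + (1 - 1 / 2 : ℝ) • (U * T * U) with hDdef
  have hD : 0 ≤ D := add_nonneg (smul_nonneg (by norm_num) hT) (smul_nonneg (by norm_num) hUT)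
  have hTU : cfc f (U * T * U) = U * cfc f T * U := by
    have := cfc_comp_of_intertwining hfc hUT hT (V := U)
      (by rw [← mul_def, ← mul_def, mul_assoc, hUU, mul_one])
    rw [← mul_def, ← mul_def] at this
    rw [← this, mul_assoc (cfc f _), hUU, mul_one]
  have hDV : D ∘L V = V ∘L S := by
    ext x
    have h1 := congr($hUV x)
    simp only [comp_apply] at h1
    have h2 : U (T (V x)) = (2 : ℝ) • V (adjoint V (T (V x))) - T (V x) := rfl
    simp only [hDdef, hSdef, comp_apply, add_apply, smul_apply, mul_def, h1, h2]
    module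
  have key := hf F T (U * T * U) hT.isSelfAdjoint hUT.isSelfAdjoint
    (fun x hx => spectrum_nonneg_of_nonneg hT hx)
    (fun x hx => spectrum_nonneg_of_nonneg hUT hx) (1 / 2) (by norm_num)
  have key2 := adjoint_comp_mono key V
  rw [← hDdef, cfc_comp_of_intertwining hfc hD hS hDV, ← comp_assoc, hV, hTU] at key2
  have e : adjoint V ∘L ((1 / 2 : ℝ) • cfc f T + (1 - 1 / 2 : ℝ) • (U * cfc f T * U)) ∘L V =
      adjoint V ∘L cfc f T ∘L V := by
    ext x
    have h1 := congr($hUV x)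
    have h2 (y : F) := congr($hVU y)
    simp only [comp_apply] at h1 h2
    simp only [comp_apply, add_apply, smul_apply, mul_def, h1, map_add,
      ← Complex.coe_smul, map_smul, h2]
    rw [← add_smul]
    norm_num
  rw [e] at key2
  exact key2

open ContinuousLinearMap in
/-- Jensen's operator inequality for an operator-valued finite probability distribution. -/
lemma OperatorConvexOn.cfc_sum_smul_le {E ι : Type} [NormedAddCommGroup E] [Fintype ι]
    [InnerProductSpace ℂ E] [CompleteSpace E] {f : ℝ → ℝ} (hf : OperatorConvexOn f)
    (hfc : ContinuousOn f (Set.Ici 0)) {t : ι → ℝ} (ht : ∀ k, 0 ≤ t k) {C : ι → E →L[ℂ] E}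
    (hC : ∀ k, 0 ≤ C k) (hC1 : ∑ k, C k = 1) :
    cfc f (∑ k, t k • C k) ≤ ∑ k, f (t k) • C k := by
  let e := (PiLp.continuousLinearEquiv 2 ℂ (fun _ : ι => E))
  let V : E →L[ℂ] PiLp 2 (fun _ : ι => E) :=
    e.symm.toContinuousLinearMap ∘L ContinuousLinearMap.pi fun k => CFC.sqrt (C k)
  let T : PiLp 2 (fun _ : ι => E) →L[ℂ] PiLp 2 (fun _ : ι => E) :=
    e.symm.toContinuousLinearMap ∘L
      ContinuousLinearMap.pi fun k => (t k : ℂ) • PiLp.proj 2 (fun _ : ι => E) k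
  have hVk (x : E) (k : ι) : V x k = CFC.sqrt (C k) x := rfl
  have hTk (x : PiLp 2 (fun _ : ι => E)) (k : ι) : T x k = (t k : ℂ) • x k := rfl
  have hsq (k : ι) (x y : E) :
      inner ℂ (CFC.sqrt (C k) x) (CFC.sqrt (C k) y) = inner ℂ (C k x) y := by
    have hs : adjoint (CFC.sqrt (C k)) = CFC.sqrt (C k) :=
      (CFC.sqrt_nonneg (C k)).isSelfAdjoint.star_eq
    have := congr($(CFC.sqrt_mul_sqrt_self (C k) (hC k)) x)
    rw [← this, mul_def, comp_apply, ← adjoint_inner_left, hs]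
  have hT : 0 ≤ T := by
    rw [nonneg_iff_isPositive, isPositive_iff_complex]
    intro x
    have hx : inner ℂ (T x) x = ((∑ k, t k * ‖x k‖ ^ 2 : ℝ) : ℂ) := by
      simp only [PiLp.inner_apply, hTk, inner_smul_left, inner_self_eq_norm_sq_to_K,
        Complex.conj_ofReal, Complex.ofReal_sum, Complex.ofReal_mul, Complex.ofReal_pow,
        Complex.coe_algebraMap]
    rw [hx]
    exact ⟨rfl, Finset.sum_nonneg fun k _ => mul_nonneg (ht k) (sq_nonneg _)⟩
  have hTf (x : PiLp 2 (fun _ : ι => E)) (k : ι) : cfc f T x k = (f (t k) : ℂ) • x k := by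
    have h0 : (0 : E →L[ℂ] E) ≤ algebraMap ℝ (E →L[ℂ] E) (t k) := algebraMap_nonneg _ (ht k)
    have := cfc_comp_of_intertwining hfc h0 hT
      (V := PiLp.proj 2 (fun _ : ι => E) k) (by
        ext x
        simp [hTk, Algebra.algebraMap_eq_smul_one])
    rw [cfc_algebraMap] at this
    have := congr($this x)
    simpa [Algebra.algebraMap_eq_smul_one] using this.symm
  have hcomp (R : PiLp 2 (fun _ : ι => E) →L[ℂ] PiLp 2 (fun _ : ι => E)) (r : ι → ℝ)
      (hR : ∀ x k, R x k = (r k : ℂ) • x k) : adjoint V ∘L R ∘L V = ∑ k, r k • C k := by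
    ext x
    refine ext_inner_right ℂ fun y => ?_
    simp only [comp_apply, adjoint_inner_left, PiLp.inner_apply, hR, hVk, inner_smul_left, hsq,
      sum_inner, sum_apply, smul_apply, ← Complex.coe_smul]
  have hV : adjoint V ∘L V = 1 := by
    have := hcomp 1 1 (by simp)
    simpa [hC1, one_def] using this
  rw [← hcomp T t hTk, ← hcomp (cfc f T) (fun k => f (t k)) hTf]
  exact hf.cfc_compression_le hfc hV hT

/-- A continuous function on `[0, M]` is approximated by interpolation along a continuous
partition of unity which reproduces the identity function. -/
lemma exists_partition_interpolation {f : ℝ → ℝ} (hf : ContinuousOn f (Set.Ici 0)) {M ε : ℝ}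
    (hM : 0 < M) (hε : 0 < ε) :
    ∃ (n : ℕ) (t : Fin n → ℝ) (h : Fin n → ℝ → ℝ), (∀ k, 0 ≤ t k) ∧ (∀ k, Continuous (h k)) ∧
      ∀ x ∈ Set.Icc 0 M, (∀ k, 0 ≤ h k x) ∧ ∑ k, h k x = 1 ∧ ∑ k, t k * h k x = x ∧
        ∑ k, f (t k) * h k x ≤ f x + ε := by
  let F : C(unitInterval, ℝ) := ⟨fun x => f (M * x), by
    refine hf.comp_continuous (by fun_prop) fun x => ?_
    exact mul_nonneg hM.le x.2.1⟩
  have hlim := bernsteinApproximation_uniform F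
  obtain ⟨n, hn, hn0⟩ := ((Metric.tendsto_nhds.1 hlim ε hε).and
    (Filter.eventually_ne_atTop 0)).exists
  refine ⟨n + 1, fun k => M * bernstein.z k,
    fun k x => (bernsteinPolynomial ℝ n k).eval (x / M),
    fun k => mul_nonneg hM.le (bernstein.z k).2.1, fun k => by fun_prop, fun x hx => ?_⟩
  let y : unitInterval := ⟨x / M, div_nonneg hx.1 hM.le, (div_le_one hM).2 hx.2⟩
  have hb (k : Fin (n + 1)) : (bernsteinPolynomial ℝ n k).eval (x / M) = bernstein n k y := rfl
  have hMy : M * (y : ℝ) = x := by simp only [y]; field_simp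
  simp only [hb]
  refine ⟨fun k => bernstein_nonneg, bernstein.probability n y, ?_, ?_⟩
  · have := congr(Polynomial.eval (x / M) $(bernsteinPolynomial.sum_smul ℝ n))
    simp only [Polynomial.eval_finsetSum, Finset.sum_range, hb, Polynomial.eval_mul,
      Polynomial.eval_natCast, Polynomial.eval_X, nsmul_eq_mul] at this
    have hn' : (n : ℝ) ≠ 0 := by exact_mod_cast hn0
    calc ∑ k : Fin (n + 1), M * (bernstein.z k : ℝ) * bernstein n k y
        = M / n * ∑ k : Fin (n + 1), (k : ℝ) * bernstein n k y := by
          rw [Finset.mul_sum]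
          refine Finset.sum_congr rfl fun k _ => ?_
          simp only [bernstein.z]
          field_simp
      _ = x := by rw [this]; field_simp
  · have h1 : dist (bernsteinApproximation n F y) (F y) < ε :=
      (ContinuousMap.dist_apply_le_dist y).trans_lt hn
    rw [Real.dist_eq] at h1
    have h2 := (abs_lt.1 h1).2
    rw [bernsteinApproximation.apply] at h2
    have h3 : F y = f x := by simp only [F, ContinuousMap.coe_mk, hMy]
    have h4 : ∑ k : Fin (n + 1), f (M * (bernstein.z k : ℝ)) * bernstein n k y =
        ∑ k : Fin (n + 1), bernstein n k y • F (bernstein.z k) :=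
      Finset.sum_congr rfl fun k _ => mul_comm _ _
    rw [h4]
    linarith

/-- Jensen's operator inequality for unital positive linear maps. -/
lemma OperatorConvexOn.cfc_map_le {E F : Type} [NormedAddCommGroup E] [InnerProductSpace ℂ E]
    [CompleteSpace E] [NormedAddCommGroup F] [InnerProductSpace ℂ F] [CompleteSpace F]
    {f : ℝ → ℝ} (hf : OperatorConvexOn f) (hfc : ContinuousOn f (Set.Ici 0))
    (Ψ : (E →L[ℂ] E) →ₗ[ℂ] (F →L[ℂ] F)) (hΨ : ∀ X, 0 ≤ X → 0 ≤ Ψ X) (hΨ1 : Ψ 1 = 1)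
    {X : E →L[ℂ] E} (hX : 0 ≤ X) :
    cfc f (Ψ X) ≤ Ψ (cfc f X) := by
  have hsmul (r : ℝ) (Y : E →L[ℂ] E) : Ψ (r • Y) = r • Ψ Y := Ψ.map_smul_of_tower r Y
  have hmono {Y Z : E →L[ℂ] E} (h : Y ≤ Z) : Ψ Y ≤ Ψ Z := by
    rw [← sub_nonneg, ← map_sub]
    exact hΨ _ (sub_nonneg.2 h)
  set M : ℝ := ‖X‖ * ‖(1 : E →L[ℂ] E)‖ + 1
  have hM : 0 < M := by positivity
  have hs (x : ℝ) (hx : x ∈ spectrum ℝ X) : x ∈ Set.Icc 0 M :=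
    ⟨spectrum_nonneg_of_nonneg hX hx,
      (le_abs_self x).trans ((spectrum.norm_le_norm_mul_of_mem hx).trans (by simp [M]))⟩
  have hfX : ContinuousOn f (spectrum ℝ X) := hfc.mono fun x hx => (hs x hx).1
  have key (ε : ℝ) (hε : 0 < ε) : cfc f (Ψ X) ≤ Ψ (cfc f X) + ε • (1 : F →L[ℂ] F) := by
    obtain ⟨n, t, h, ht, hh, H⟩ := exists_partition_interpolation hfc hM hε
    have e1 : ∑ k, cfc (h k) X = 1 := by
      rw [← cfc_sum_univ (fun k => h k) X (fun k => (hh k).continuousOn), ← cfc_one ℝ X]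
      refine cfc_congr fun x hx => ?_
      simpa using (H x (hs x hx)).2.1
    have e2 : ∑ k, t k • cfc (h k) X = X := by
      simp_rw [fun k => (cfc_const_mul (t k) (h k) X (hh k).continuousOn).symm]
      rw [← cfc_sum_univ (fun k x => t k * h k x) X (fun k => by have := hh k; fun_prop)]
      conv_rhs => rw [← cfc_id ℝ X]
      refine cfc_congr fun x hx => ?_
      simpa using (H x (hs x hx)).2.2.1
    have e3 : ∑ k, f (t k) • cfc (h k) X ≤ cfc f X + ε • 1 := by
      simp_rw [fun k => (cfc_const_mul (f (t k)) (h k) X (hh k).continuousOn).symm]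
      rw [← cfc_sum_univ (fun k x => f (t k) * h k x) X (fun k => by have := hh k; fun_prop),
        ← Algebra.algebraMap_eq_smul_one, ← cfc_add_const ε f X hfX]
      refine cfc_mono (fun x hx => ?_)
        (Continuous.continuousOn ?_) (by fun_prop)
      · simpa using (H x (hs x hx)).2.2.2
      · rw [Finset.sum_fn]
        exact continuous_finsetSum _ fun k _ => (hh k).const_mul _
    have hC (k : Fin n) : 0 ≤ Ψ (cfc (h k) X) :=
      hΨ _ (cfc_nonneg fun x hx => (H x (hs x hx)).1 k)
    have hC1 : ∑ k, Ψ (cfc (h k) X) = 1 := by rw [← map_sum, e1, hΨ1]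
    calc cfc f (Ψ X) = cfc f (∑ k, t k • Ψ (cfc (h k) X)) := by
          conv_lhs => rw [← e2, map_sum]
          simp_rw [hsmul]
      _ ≤ ∑ k, f (t k) • Ψ (cfc (h k) X) := hf.cfc_sum_smul_le hfc ht hC hC1
      _ = Ψ (∑ k, f (t k) • cfc (h k) X) := by rw [map_sum]; simp_rw [hsmul]
      _ ≤ Ψ (cfc f X + ε • 1) := hmono e3
      _ = _ := by rw [map_add, hsmul, hΨ1]
  have hlim : Filter.Tendsto (fun ε : ℝ => Ψ (cfc f X) + ε • (1 : F →L[ℂ] F))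
      (nhdsWithin 0 (Set.Ioi 0)) (nhds (Ψ (cfc f X))) := by
    have : Continuous fun ε : ℝ => Ψ (cfc f X) + ε • (1 : F →L[ℂ] F) := by fun_prop
    simpa using (this.tendsto 0).mono_left nhdsWithin_le_nhds
  exact ge_of_tendsto hlim (Filter.eventually_of_mem self_mem_nhdsWithin key)

lemma opSqrt_isSelfAdjoint (R : H →L[ℂ] H) : IsSelfAdjoint (opSqrt R) :=
  cfc_predicate _ _

lemma opInvSqrt_isSelfAdjoint (R : H →L[ℂ] H) : IsSelfAdjoint (opInvSqrt R) :=
  cfc_predicate _ _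

lemma opSqrt_mul_opSqrt {R : H →L[ℂ] H} (hR : 0 ≤ R) : opSqrt R * opSqrt R = R := by
  rw [opSqrt, ← cfc_mul Real.sqrt Real.sqrt R]
  conv_rhs => rw [← cfc_id ℝ R]
  exact cfc_congr fun x hx => Real.mul_self_sqrt (spectrum_nonneg_of_nonneg hR hx)

lemma spectrum_pos_of_isUnit {R : H →L[ℂ] H} (hR : 0 ≤ R) (hu : IsUnit R) {x : ℝ}
    (hx : x ∈ spectrum ℝ R) : 0 < x :=
  (spectrum_nonneg_of_nonneg hR hx).lt_of_ne fun h =>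
    spectrum.zero_notMem ℝ hu (h ▸ hx)

lemma continuousOn_inv_sqrt_spectrum {R : H →L[ℂ] H} (hR : 0 ≤ R) (hu : IsUnit R) :
    ContinuousOn (fun t : ℝ => (Real.sqrt t)⁻¹) (spectrum ℝ R) :=
  Real.continuous_sqrt.continuousOn.inv₀ fun _ hx =>
    (Real.sqrt_pos.2 (spectrum_pos_of_isUnit hR hu hx)).ne'

lemma opSqrt_mul_opInvSqrt {R : H →L[ℂ] H} (hR : 0 ≤ R) (hu : IsUnit R) :
    opSqrt R * opInvSqrt R = 1 := by
  rw [opSqrt, opInvSqrt,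
    ← cfc_mul _ _ R (by fun_prop) (continuousOn_inv_sqrt_spectrum hR hu), ← cfc_one ℝ R]
  exact cfc_congr fun x hx =>
    mul_inv_cancel₀ (Real.sqrt_pos.2 (spectrum_pos_of_isUnit hR hu hx)).ne'

lemma opInvSqrt_mul_opSqrt {R : H →L[ℂ] H} (hR : 0 ≤ R) (hu : IsUnit R) :
    opInvSqrt R * opSqrt R = 1 := by
  rw [opSqrt, opInvSqrt,
    ← cfc_mul _ _ R (continuousOn_inv_sqrt_spectrum hR hu) (by fun_prop), ← cfc_one ℝ R]
  exact cfc_congr fun x hx =>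
    inv_mul_cancel₀ (Real.sqrt_pos.2 (spectrum_pos_of_isUnit hR hu hx)).ne.symm

/-- If `f` is operator convex with `f(0) ≤ 0` and `Φ` is a positive linear map with
`Φ(I) ≤ I`, then `g(Φ(A), Φ(B)) ≤ Φ(g(A, B))` for positive `A` and strictly positive
`B` with `Φ(B)` strictly positive. -/
theorem stmt_6 {K : Type} [NormedAddCommGroup K] [InnerProductSpace ℂ K] [CompleteSpace K]
    (f : ℝ → ℝ) (hf_cont : ContinuousOn f (Set.Ici (0 : ℝ)))
    (hf : OperatorConvexOn f) (hf0 : f 0 ≤ 0)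
    (Φ : (H →L[ℂ] H) →ₗ[ℂ] (K →L[ℂ] K))
    (hΦpos : ∀ A : H →L[ℂ] H, 0 ≤ A → 0 ≤ Φ A) (hΦ1 : Φ 1 ≤ 1)
    (A B : H →L[ℂ] H) (hA : 0 ≤ A) (hB : 0 ≤ B) (hBu : IsUnit B) (hΦB : IsUnit (Φ B)) :
    persp f (Φ A) (Φ B) ≤ Φ (persp f A B) := by
  have hΦB0 : 0 ≤ Φ B := hΦpos B hB
  set s := opSqrt B
  set s' := opInvSqrt B
  set r := opSqrt (Φ B)
  set r' := opInvSqrt (Φ B)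
  have hs : IsSelfAdjoint s := opSqrt_isSelfAdjoint B
  have hs' : IsSelfAdjoint s' := opInvSqrt_isSelfAdjoint B
  have hrs : IsSelfAdjoint r := opSqrt_isSelfAdjoint (Φ B)
  have hrs' : IsSelfAdjoint r' := opInvSqrt_isSelfAdjoint (Φ B)
  have hss' : s * s' = 1 := opSqrt_mul_opInvSqrt hB hBu
  have hs's : s' * s = 1 := opInvSqrt_mul_opSqrt hB hBu
  have hrr' : r * r' = 1 := opSqrt_mul_opInvSqrt hΦB0 hΦB
  have hr'r : r' * r = 1 := opInvSqrt_mul_opSqrt hΦB0 hΦB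
  have hss : s * s = B := opSqrt_mul_opSqrt hB
  have hrr : r * r = Φ B := opSqrt_mul_opSqrt hΦB0
  let Ψ : (H →L[ℂ] H) →ₗ[ℂ] (K →L[ℂ] K) :=
    LinearMap.mulLeftRight ℂ (r', r') ∘ₗ Φ ∘ₗ LinearMap.mulLeftRight ℂ (s, s)
  have hΨ (X : H →L[ℂ] H) : Ψ X = r' * Φ (s * X * s) * r' := rfl
  have hΨpos (X : H →L[ℂ] H) (hX : 0 ≤ X) : 0 ≤ Ψ X := by
    rw [hΨ]
    exact hrs'.conjugate_nonneg (hΦpos _ (hs.conjugate_nonneg hX))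
  have hΨ1 : Ψ 1 = 1 := by
    rw [hΨ, mul_one, hss, ← hrr, ← mul_assoc, hr'r, one_mul, hrr']
  have hX : 0 ≤ s' * A * s' := hs'.conjugate_nonneg hA
  have hsX : s * (s' * A * s') * s = A := by
    rw [mul_assoc s' A s', ← mul_assoc s s', hss', one_mul, mul_assoc, hs's, mul_one]
  have key := hrs.conjugate_le_conjugate (hf.cfc_map_le hf_cont Ψ hΨpos hΨ1 hX)
  rw [hΨ, hΨ, hsX] at key
  have e (Y : K →L[ℂ] K) : r * (r' * Y * r') * r = Y := by
    rw [mul_assoc r' Y r', ← mul_assoc r r', hrr', one_mul, mul_assoc, hr'r, mul_one]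
  rw [e] at key
  exact key
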